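/- For every integer n ≥ 2, the total Gauss curvature of the lifted equivariant moduli space equals 4π: explicitly, 2π ∫₀^∞ ρ F̃_n(ρ) κ̃_n(ρ) dρ = 4π, where κ̃_n(ρ) = -(1/(ρ F̃_n(ρ))) · d/dρ ( ρ F̃_n'(ρ) / (2 F̃_n(ρ)) ) and F̃_n(ρ) = π n² ∫₀^∞ s^n / ((ρ²+s)² (1+s^n)²) ds. Consequently the total Gauss curvature of the equivariant moduli space R_eq,n, which is 1/n times this quantity, equals 4π/n. -/

import Mathlib

open MeasureTheory Real Set

open Filter Topology

/-- The generalized Stieltjes transform of order `k` of a weight `w` on `(0, ∞)`. -/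
noncomputable def stieltjes (w : ℝ → ℝ) (k : ℕ) (x : ℝ) : ℝ :=
  ∫ s in Ioi (0 : ℝ), w s / (x + s) ^ k

section Stieltjes

variable {w : ℝ → ℝ}

lemma aestronglyMeasurable_div_add_pow (hi : IntegrableOn w (Ioi 0)) (k : ℕ) (x : ℝ) :
    AEStronglyMeasurable (fun s => w s / (x + s) ^ k) (volume.restrict (Ioi 0)) :=
  (hi.aemeasurable.div (by fun_prop)).aestronglyMeasurable

lemma integrableOn_div_add_pow (hi : IntegrableOn w (Ioi 0)) (k : ℕ) {x : ℝ} (hx : 0 < x) :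
    IntegrableOn (fun s => w s / (x + s) ^ k) (Ioi 0) := by
  refine Integrable.mono' (hi.norm.div_const (x ^ k))
    (aestronglyMeasurable_div_add_pow hi k x) ?_
  filter_upwards [ae_restrict_mem measurableSet_Ioi] with s hs
  have hs : 0 < s := hs
  rw [norm_div, norm_pow, Real.norm_of_nonneg (by positivity : 0 ≤ x + s)]
  gcongr
  linarith

lemma setIntegral_Ioi_pos {f : ℝ → ℝ} (hi : IntegrableOn f (Ioi 0)) (hf : ∀ s, 0 < s → 0 < f s) :
    0 < ∫ s in Ioi (0 : ℝ), f s := by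
  rw [setIntegral_pos_iff_support_of_nonneg_ae _ hi]
  · have : Function.support f ∩ Ioi 0 = Ioi 0 :=
      inter_eq_right.2 fun s hs => (hf s hs).ne'
    simp [this]
  · filter_upwards [ae_restrict_mem measurableSet_Ioi] with s hs using (hf s hs).le

lemma stieltjes_pos (hi : IntegrableOn w (Ioi 0)) (hw : ∀ s, 0 < s → 0 < w s) (k : ℕ)
    {x : ℝ} (hx : 0 < x) : 0 < stieltjes w k x :=
  setIntegral_Ioi_pos (integrableOn_div_add_pow hi k hx) fun s hs => by
    have := hw s hs
    positivity

lemma stieltjes_anti (hi : IntegrableOn w (Ioi 0)) (hw : ∀ s, 0 < s → 0 < w s) (k : ℕ)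
    {x y : ℝ} (hx : 0 < x) (hxy : x ≤ y) : stieltjes w k y ≤ stieltjes w k x :=
  setIntegral_mono_on (integrableOn_div_add_pow hi k (hx.trans_le hxy))
    (integrableOn_div_add_pow hi k hx) measurableSet_Ioi fun s hs => by
      have hs : 0 < s := hs
      have := hw s hs
      gcongr

lemma hasDerivAt_stieltjes (hi : IntegrableOn w (Ioi 0)) (k : ℕ) {x : ℝ} (hx : 0 < x) :
    HasDerivAt (stieltjes w k) (-k * stieltjes w (k + 1) x) x := by
  have key := hasDerivAt_integral_of_dominated_loc_of_deriv_le
    (μ := volume.restrict (Ioi (0 : ℝ))) (F := fun x s => w s / (x + s) ^ k)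
    (F' := fun x s => -k * (w s / (x + s) ^ (k + 1)))
    (bound := fun s => k * (|w s| / (x / 2) ^ (k + 1)))
    (Ioi_mem_nhds (half_lt_self hx))
    (Eventually.of_forall fun y => aestronglyMeasurable_div_add_pow hi k y)
    (integrableOn_div_add_pow hi k hx)
    ((aestronglyMeasurable_div_add_pow hi (k + 1) x).const_mul _) ?_
    ((hi.abs.div_const _).const_mul _) ?_
  · have := key.2
    rwa [integral_const_mul] at this
  · filter_upwards [ae_restrict_mem measurableSet_Ioi] with s hs y hy
    have hs : 0 < s := hs
    have hy : x / 2 < y := hy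
    have hy0 : 0 < y + s := by linarith
    rw [norm_mul, norm_neg, Real.norm_of_nonneg (Nat.cast_nonneg k), norm_div, norm_pow,
      Real.norm_of_nonneg hy0.le, Real.norm_eq_abs]
    gcongr
    linarith
  · filter_upwards [ae_restrict_mem measurableSet_Ioi] with s hs y hy
    have hs : 0 < s := hs
    have hy : x / 2 < y := hy
    have hy0 : y + s ≠ 0 := by linarith
    have h := (((hasDerivAt_id y).add_const s).pow k).fun_inv (pow_ne_zero k hy0)
    refine (h.const_mul (w s)).congr_deriv ?_
    rcases k with _ | k
    · simp
    · simp only [id, Pi.pow_apply, Nat.add_sub_cancel]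
      field_simp
      ring

lemma setIntegral_comp_mul_div_one_add_pow (k : ℕ) {x : ℝ} (hx : 0 < x) :
    ∫ u in Ioi (0 : ℝ), w (x * u) / (1 + u) ^ k = x ^ k * x⁻¹ * stieltjes w k x := by
  have h := integral_comp_mul_left_Ioi (fun s => w s / (x + s) ^ k) 0 hx
  rw [mul_zero, smul_eq_mul] at h
  rw [stieltjes, mul_assoc, ← h, ← integral_const_mul]
  refine setIntegral_congr_fun measurableSet_Ioi fun u hu => ?_
  have hu : 0 < u := hu
  have : x + x * u = x * (1 + u) := by ring
  simp only [this, mul_pow]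
  field_simp

/-- If the weight has a monotone likelihood ratio under dilations, then `x S₃(x) / S₂(x)`, the mean
of `1 / (1 + u)` for the density `w (x u) / (1 + u) ^ 2`, is nondecreasing in `x`. -/
lemma monotoneOn_mul_stieltjes_div (hi : IntegrableOn w (Ioi 0)) (hw : ∀ s, 0 < s → 0 < w s)
    (hlr : ∀ x y u v, 0 < x → x ≤ y → 0 < u → u ≤ v →
      w (y * v) * w (x * u) ≤ w (y * u) * w (x * v)) :
    MonotoneOn (fun x => x * stieltjes w 3 x / stieltjes w 2 x) (Ioi 0) := by
  intro x hx y hy hxy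
  have hx : 0 < x := hx
  have hy : 0 < y := hy
  have hcomp : ∀ {z : ℝ}, 0 < z → IntegrableOn (fun u => w (z * u)) (Ioi 0) := fun {z} hz => by
    rw [integrableOn_Ioi_comp_mul_left_iff _ _ hz, mul_zero]
    exact hi
  have hAi : ∀ (k : ℕ) {z : ℝ}, 0 < z →
      IntegrableOn (fun u => w (z * u) / (1 + u) ^ k) (Ioi 0) :=
    fun k z hz => integrableOn_div_add_pow (hcomp hz) k one_pos
  set A : ℕ → ℝ → ℝ := fun k z => ∫ u in Ioi (0 : ℝ), w (z * u) / (1 + u) ^ k with hA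
  have hApos : ∀ (k : ℕ) {z : ℝ}, 0 < z → 0 < A k z := fun k z hz =>
    setIntegral_Ioi_pos (hAi k hz) fun u hu => by
      have := hw (z * u) (by positivity)
      positivity
  have hq : ∀ {z : ℝ}, 0 < z → z * stieltjes w 3 z / stieltjes w 2 z = A 3 z / A 2 z := by
    intro z hz
    have := stieltjes_pos hi hw 2 hz
    simp only [hA, setIntegral_comp_mul_div_one_add_pow _ hz]
    field_simp
  simp only [hq hx, hq hy]
  have h2 := hApos 2 hx
  have h3 := hApos 3 hx
  have h23 : A 3 x < A 2 x := by
    rw [← sub_pos, hA]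
    simp only
    rw [← integral_sub (hAi 2 hx) (hAi 3 hx)]
    refine setIntegral_Ioi_pos ((hAi 2 hx).sub (hAi 3 hx)) fun u hu => ?_
    have := hw (x * u) (by positivity)
    have : w (x * u) / (1 + u) ^ 2 - w (x * u) / (1 + u) ^ 3 = w (x * u) * u / (1 + u) ^ 3 := by
      field_simp
      ring
    rw [this]
    positivity
  set m := A 3 x / A 2 x with hm
  set c := A 2 x / A 3 x - 1 with hc
  have hc0 : 0 < c := by
    rw [hc, sub_pos, lt_div_iff₀ h3]
    linarith
  have hmc : m = 1 / (1 + c) := by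
    rw [hm, hc, add_sub_cancel, one_div_div]
  have key : 0 ≤ ∫ u in Ioi (0 : ℝ),
      (w (x * c) * (w (y * u) / (1 + u) ^ 3 - m * (w (y * u) / (1 + u) ^ 2)) -
        w (y * c) * (w (x * u) / (1 + u) ^ 3 - m * (w (x * u) / (1 + u) ^ 2))) := by
    refine setIntegral_nonneg measurableSet_Ioi fun u hu => ?_
    have hu : 0 < u := hu
    have hrw : w (x * c) * (w (y * u) / (1 + u) ^ 3 - m * (w (y * u) / (1 + u) ^ 2)) -
        w (y * c) * (w (x * u) / (1 + u) ^ 3 - m * (w (x * u) / (1 + u) ^ 2)) =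
        (c - u) * (w (y * u) * w (x * c) - w (y * c) * w (x * u)) /
          ((1 + c) * (1 + u) ^ 3) := by
      rw [hmc]
      field_simp
      ring
    rw [hrw]
    refine div_nonneg ?_ (by positivity)
    rcases le_total u c with h | h
    · exact mul_nonneg (sub_nonneg.2 h) (sub_nonneg.2 (hlr x y u c hx hxy hu h))
    · exact mul_nonneg_of_nonpos_of_nonpos (sub_nonpos.2 h)
        (sub_nonpos.2 (hlr x y c u hx hxy hc0 h))
  have hsub : ∀ {z : ℝ}, 0 < z → IntegrableOn
      (fun u => w (z * u) / (1 + u) ^ 3 - m * (w (z * u) / (1 + u) ^ 2)) (Ioi 0) :=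
    fun hz => (hAi 3 hz).sub ((hAi 2 hz).const_mul m)
  have hval : ∀ {z : ℝ}, 0 < z →
      ∫ u in Ioi (0 : ℝ), (w (z * u) / (1 + u) ^ 3 - m * (w (z * u) / (1 + u) ^ 2)) =
        A 3 z - m * A 2 z := fun hz => by
    rw [integral_sub (hAi 3 hz) ((hAi 2 hz).const_mul m), integral_const_mul]
  rw [integral_sub ((hsub hy).const_mul _) ((hsub hx).const_mul _), integral_const_mul,
    integral_const_mul, hval hx, hval hy] at key
  have hzero : A 3 x - m * A 2 x = 0 := by
    rw [hm]
    field_simp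
    ring
  rw [hzero, mul_zero, sub_zero] at key
  have := nonneg_of_mul_nonneg_right key (hw (x * c) (by positivity))
  rw [le_div_iff₀ (hApos 2 hy)]
  linarith

lemma tendsto_pow_mul_stieltjes_atTop (hi : IntegrableOn w (Ioi 0)) (k : ℕ) :
    Tendsto (fun x => x ^ k * stieltjes w k x) atTop (𝓝 (∫ s in Ioi (0 : ℝ), w s)) := by
  simp only [stieltjes, ← integral_const_mul]
  refine tendsto_integral_filter_of_dominated_convergence (fun s => |w s|)
    (Eventually.of_forall fun x => (aestronglyMeasurable_div_add_pow hi k x).const_mul _) ?_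
    hi.abs ?_
  · filter_upwards [eventually_gt_atTop 0] with x hx
    filter_upwards [ae_restrict_mem measurableSet_Ioi] with s hs
    have hs : 0 < s := hs
    rw [norm_mul, norm_div, norm_pow, norm_pow, Real.norm_of_nonneg hx.le,
      Real.norm_of_nonneg (by positivity : 0 ≤ x + s), Real.norm_eq_abs, mul_div_left_comm]
    refine mul_le_of_le_one_right (abs_nonneg _) (div_le_one_of_le₀ ?_ (by positivity))
    gcongr
    linarith
  · filter_upwards [ae_restrict_mem measurableSet_Ioi] with s hs
    have hs : 0 < s := hs
    have h1 : Tendsto (fun x : ℝ => 1 - s / (x + s)) atTop (𝓝 (1 - 0)) :=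
      tendsto_const_nhds.sub
        (tendsto_const_nhds.div_atTop (tendsto_atTop_add_const_right _ _ tendsto_id))
    have h2 := (h1.pow k).const_mul (w s)
    rw [sub_zero, one_pow, mul_one] at h2
    refine h2.congr' ?_
    filter_upwards [eventually_gt_atTop 0] with x hx
    have : 1 - s / (x + s) = x / (x + s) := by
      field_simp
      ring
    rw [this, div_pow, mul_div_left_comm]

lemma tendsto_mul_stieltjes_div_atTop (hi : IntegrableOn w (Ioi 0))
    (hw : ∀ s, 0 < s → 0 < w s) :
    Tendsto (fun x => x * stieltjes w 3 x / stieltjes w 2 x) atTop (𝓝 1) := by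
  have hI := setIntegral_Ioi_pos hi hw
  have h := (tendsto_pow_mul_stieltjes_atTop hi 3).div (tendsto_pow_mul_stieltjes_atTop hi 2) hI.ne'
  rw [div_self hI.ne'] at h
  refine h.congr' ?_
  filter_upwards [eventually_gt_atTop 0] with x hx
  have := stieltjes_pos hi hw 2 hx
  simp only [Pi.div_apply]
  field_simp

lemma tendsto_mul_stieltjes_zero (hi : IntegrableOn w (Ioi 0))
    (hi2 : IntegrableOn (fun s => w s / s ^ 2) (Ioi 0)) :
    Tendsto (fun x => x * stieltjes w 3 x) (𝓝[>] 0) (𝓝 0) := by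
  have h0 : 𝓝 (0 : ℝ) = 𝓝 (∫ _s in Ioi (0 : ℝ), (0 : ℝ)) := by simp
  simp only [stieltjes, ← integral_const_mul]
  rw [h0]
  refine tendsto_integral_filter_of_dominated_convergence (fun s => |w s / s ^ 2|)
    (Eventually.of_forall fun x => (aestronglyMeasurable_div_add_pow hi 3 x).const_mul _) ?_
    hi2.abs ?_
  · filter_upwards [self_mem_nhdsWithin] with x hx
    filter_upwards [ae_restrict_mem measurableSet_Ioi] with s hs
    have hs : 0 < s := hs
    have hx : 0 < x := hx
    rw [norm_mul, norm_div, norm_pow, Real.norm_of_nonneg hx.le,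
      Real.norm_of_nonneg (by positivity : 0 ≤ x + s), Real.norm_eq_abs, mul_div_left_comm,
      abs_div, abs_of_nonneg (by positivity : 0 ≤ s ^ 2), div_eq_mul_one_div |w s|]
    gcongr ?_ * ?_
    rw [div_le_div_iff₀ (by positivity) (by positivity)]
    nlinarith [mul_pos hx hs, pow_pos hx 2, pow_pos hx 3, pow_pos hs 3,
      mul_pos hx (pow_pos hs 2), mul_pos (pow_pos hx 2) hs]
  · filter_upwards [ae_restrict_mem measurableSet_Ioi] with s hs
    have hs : 0 < s := hs
    have hc : ContinuousAt (fun x : ℝ => x * (w s / (x + s) ^ 3)) 0 := by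
      have : (0 + s) ^ 3 ≠ 0 := by positivity
      fun_prop (disch := assumption)
    have := hc.tendsto
    rw [zero_mul] at this
    exact this.mono_left nhdsWithin_le_nhds

lemma tendsto_mul_stieltjes_div_zero (hi : IntegrableOn w (Ioi 0))
    (hi2 : IntegrableOn (fun s => w s / s ^ 2) (Ioi 0)) (hw : ∀ s, 0 < s → 0 < w s) :
    Tendsto (fun x => x * stieltjes w 3 x / stieltjes w 2 x) (𝓝[>] 0) (𝓝 0) := by
  have h := (tendsto_mul_stieltjes_zero hi hi2).div_const (stieltjes w 2 1)
  rw [zero_div] at h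
  refine squeeze_zero' ?_ ?_ h
  · filter_upwards [self_mem_nhdsWithin] with x hx
    have hx : 0 < x := hx
    have := stieltjes_pos hi hw 2 hx
    have := stieltjes_pos hi hw 3 hx
    positivity
  · filter_upwards [Ioc_mem_nhdsGT one_pos] with x hx
    have hx0 := hx.1
    have := stieltjes_pos hi hw 2 one_pos
    have := stieltjes_pos hi hw 3 hx0
    have := stieltjes_anti hi hw 2 hx0 hx.2
    gcongr

lemma hasDerivAt_mul_stieltjes_div (hi : IntegrableOn w (Ioi 0)) (hw : ∀ s, 0 < s → 0 < w s)
    (hlr : ∀ x y u v, 0 < x → x ≤ y → 0 < u → u ≤ v →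
      w (y * v) * w (x * u) ≤ w (y * u) * w (x * v)) {x : ℝ} (hx : 0 < x) :
    ∃ d, 0 ≤ d ∧ HasDerivAt (fun x => x * stieltjes w 3 x / stieltjes w 2 x) d x := by
  have hd : DifferentiableAt ℝ (fun x => x * stieltjes w 3 x / stieltjes w 2 x) x :=
    ((hasDerivAt_id x).mul (hasDerivAt_stieltjes hi 3 hx)).differentiableAt.div
      (hasDerivAt_stieltjes hi 2 hx).differentiableAt (stieltjes_pos hi hw 2 hx).ne'
  refine ⟨_, ?_, hd.hasDerivAt⟩
  rw [← derivWithin_of_isOpen isOpen_Ioi hx]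
  exact (monotoneOn_mul_stieltjes_div hi hw hlr).derivWithin_nonneg

/-- Total curvature of the metric `F (dρ² + ρ² dλ²)` with `F ρ = C S₂(ρ²)`, up to the factor `2π`
and written as an exact derivative. -/
lemma integral_deriv_log_stieltjes (hi : IntegrableOn w (Ioi 0))
    (hi2 : IntegrableOn (fun s => w s / s ^ 2) (Ioi 0)) (hw : ∀ s, 0 < s → 0 < w s)
    (hlr : ∀ x y u v, 0 < x → x ≤ y → 0 < u → u ≤ v →
      w (y * v) * w (x * u) ≤ w (y * u) * w (x * v))
    {C : ℝ} (hC : 0 < C) {F : ℝ → ℝ} (hF : ∀ ρ, F ρ = C * stieltjes w 2 (ρ ^ 2)) :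
    ∫ ρ in Ioi (0 : ℝ), deriv (fun t => t * deriv F t / (2 * F t)) ρ = -2 := by
  set q : ℝ → ℝ := fun x => x * stieltjes w 3 x / stieltjes w 2 x with hq
  set g : ℝ → ℝ := fun t => t * deriv F t / (2 * F t) with hg
  have hFfun : F = fun ρ => C * stieltjes w 2 (ρ ^ 2) := funext hF
  have hgq : ∀ t, 0 < t → g t = -2 * q (t ^ 2) := by
    intro t ht
    have ht2 : 0 < t ^ 2 := by positivity
    have h := ((hasDerivAt_stieltjes hi 2 ht2).comp (h := fun t => t ^ 2) t
      (hasDerivAt_pow 2 t)).const_mul C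
    have hd : deriv F t = C * (-(2 : ℕ) * stieltjes w 3 (t ^ 2) * ((2 : ℕ) * t ^ (2 - 1))) := by
      rw [hFfun]
      exact h.deriv
    have := stieltjes_pos hi hw 2 ht2
    simp only [hg, hq, hd, hF]
    push_cast
    field_simp
  have hderiv : ∀ t ∈ Ioi (0 : ℝ), ∃ d, d ≤ 0 ∧ HasDerivAt g d t := by
    intro t ht
    have ht : 0 < t := ht
    obtain ⟨d, hd0, hd⟩ := hasDerivAt_mul_stieltjes_div hi hw hlr (pow_pos ht 2)
    refine ⟨_, ?_, ((hd.comp (h := fun t => t ^ 2) t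
      (hasDerivAt_pow 2 t)).const_mul (-2)).congr_of_eventuallyEq ?_⟩
    · have : 0 ≤ d * ((2 : ℕ) * t ^ (2 - 1)) := by positivity
      linarith
    · filter_upwards [Ioi_mem_nhds ht] with u hu using hgq u hu
  have hg0 : g 0 = 0 := by simp [hg]
  have hcont : ContinuousWithinAt g (Ici 0) 0 := by
    rw [← continuousWithinAt_Ioi_iff_Ici, ContinuousWithinAt, hg0]
    have hsq : Tendsto (fun t : ℝ => t ^ 2) (𝓝[>] 0) (𝓝[>] 0) := by
      refine tendsto_nhdsWithin_iff.2 ⟨?_, ?_⟩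
      · have : ContinuousAt (fun t : ℝ => t ^ 2) 0 := by fun_prop
        have := this.tendsto
        rw [zero_pow two_ne_zero] at this
        exact this.mono_left nhdsWithin_le_nhds
      · filter_upwards [self_mem_nhdsWithin] with t ht using pow_pos (mem_Ioi.1 ht) 2
    have h := ((tendsto_mul_stieltjes_div_zero hi hi2 hw).comp hsq).const_mul (-2)
    rw [mul_zero] at h
    refine h.congr' ?_
    filter_upwards [self_mem_nhdsWithin] with t ht using (hgq t ht).symm
  have htop : Tendsto g atTop (𝓝 (-2)) := by
    have h := ((tendsto_mul_stieltjes_div_atTop hi hw).comp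
      (tendsto_pow_atTop two_ne_zero)).const_mul (-2)
    rw [mul_one] at h
    refine h.congr' ?_
    filter_upwards [eventually_gt_atTop 0] with t ht using (hgq t ht).symm
  rw [integral_Ioi_of_hasDerivAt_of_nonpos hcont (g' := deriv g) ?_ ?_ htop, hg0, sub_zero]
  · intro t ht
    obtain ⟨d, -, hd⟩ := hderiv t ht
    exact hd.differentiableAt.hasDerivAt
  · intro t ht
    obtain ⟨d, hd0, hd⟩ := hderiv t ht
    rwa [hd.deriv]

end Stieltjes

lemma pow_add_pow_le_two_mul_sq {n j : ℕ} (hj : j + 2 ≤ 2 * n) {s : ℝ} (hs : 0 < s) :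
    s ^ j * (1 + s ^ 2) ≤ 2 * (1 + s ^ n) ^ 2 := by
  have hb : ∀ i, i ≤ 2 * n → s ^ i ≤ (1 + s ^ n) ^ 2 := by
    intro i hin
    have hn := pow_pos hs n
    rcases le_total s 1 with h | h
    · have := pow_le_one₀ (n := i) hs.le h
      nlinarith
    · have := pow_le_pow_right₀ h hin
      rw [mul_comm 2 n, pow_mul] at this
      nlinarith
  have h1 := hb j (by omega)
  have h2 := hb (j + 2) hj
  rw [mul_add, ← pow_add, mul_one]
  linarith

lemma integrableOn_pow_div_one_add_pow_sq {n j : ℕ} (hj : j + 2 ≤ 2 * n) :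
    IntegrableOn (fun s : ℝ => s ^ j / (1 + s ^ n) ^ 2) (Ioi 0) := by
  refine Integrable.mono' (integrable_inv_one_add_sq.const_mul 2).integrableOn
    (Measurable.aestronglyMeasurable (by fun_prop)) ?_
  filter_upwards [ae_restrict_mem measurableSet_Ioi] with s hs
  have hs : 0 < s := hs
  rw [Real.norm_of_nonneg (by positivity), ← div_eq_mul_inv,
    div_le_div_iff₀ (by positivity) (by positivity)]
  exact pow_add_pow_le_two_mul_sq hj hs

lemma pow_div_one_add_pow_sq_likelihood_ratio (n : ℕ) {x y u v : ℝ} (hx : 0 < x) (hxy : x ≤ y)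
    (hu : 0 < u) (huv : u ≤ v) :
    (y * v) ^ n / (1 + (y * v) ^ n) ^ 2 * ((x * u) ^ n / (1 + (x * u) ^ n) ^ 2) ≤
      (y * u) ^ n / (1 + (y * u) ^ n) ^ 2 * ((x * v) ^ n / (1 + (x * v) ^ n) ^ 2) := by
  have hy := hx.trans_le hxy
  have hv := hu.trans_le huv
  have hxy' : x ^ n ≤ y ^ n := by gcongr
  have huv' : u ^ n ≤ v ^ n := by gcongr
  simp only [mul_pow, div_mul_div_comm]
  have hnum : y ^ n * v ^ n * (x ^ n * u ^ n) = y ^ n * u ^ n * (x ^ n * v ^ n) := by ring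
  rw [hnum, ← mul_pow (1 + y ^ n * v ^ n), ← mul_pow (1 + y ^ n * u ^ n)]
  gcongr _ / ?_ ^ 2
  nlinarith [mul_nonneg (sub_nonneg.2 hxy') (sub_nonneg.2 huv')]

/-- For every integer `n ≥ 2`, the total Gauss curvature of the lifted equivariant moduli
space equals `4π`: `2π ∫₀^∞ ρ F̃ₙ(ρ) κ̃ₙ(ρ) dρ = 4π`, where
`κ̃ₙ(ρ) = -(1/(ρ F̃ₙ(ρ))) · d/dρ (ρ F̃ₙ'(ρ) / (2 F̃ₙ(ρ)))` and
`F̃ₙ(ρ) = π n² ∫₀^∞ sⁿ / ((ρ²+s)² (1+sⁿ)²) ds`. Consequently the total Gauss curvature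
of `R_eq,n`, which is `1/n` times this quantity, equals `4π/n`. -/
theorem total_gauss_curvature (n : ℕ) (hn : 2 ≤ n) (F : ℝ → ℝ) (κ : ℝ → ℝ)
    (hF : ∀ ρ : ℝ, F ρ = π * (n:ℝ)^2 * ∫ s in Ioi (0:ℝ),
      s ^ n / ((ρ^2 + s)^2 * (1 + s^n)^2))
    (hκ : ∀ ρ : ℝ, κ ρ = -(1 / (ρ * F ρ)) *
      deriv (fun t : ℝ => t * deriv F t / (2 * F t)) ρ) :
    2 * π * (∫ ρ in Ioi (0:ℝ), ρ * F ρ * κ ρ) = 4 * π ∧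
    (1 / (n:ℝ)) * (2 * π * ∫ ρ in Ioi (0:ℝ), ρ * F ρ * κ ρ) = 4 * π / n := by
  have hn0 : (0 : ℝ) < n := by exact_mod_cast (by omega : 0 < n)
  have hi : IntegrableOn (fun s : ℝ => s ^ n / (1 + s ^ n) ^ 2) (Ioi 0) :=
    integrableOn_pow_div_one_add_pow_sq (by omega)
  have hw : ∀ s : ℝ, 0 < s → 0 < s ^ n / (1 + s ^ n) ^ 2 := fun s hs => by positivity
  have hi2 : IntegrableOn (fun s : ℝ => s ^ n / (1 + s ^ n) ^ 2 / s ^ 2) (Ioi 0) := by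
    refine (integrableOn_pow_div_one_add_pow_sq (n := n) (j := n - 2) (by omega)).congr_fun
      (fun s hs => ?_) measurableSet_Ioi
    have hs : 0 < s := hs
    have : s ^ n / s ^ 2 = s ^ (n - 2) := by
      rw [div_eq_iff (by positivity), ← pow_add, Nat.sub_add_cancel hn]
    rw [div_right_comm, this]
  have hFS : ∀ ρ, F ρ =
      π * (n : ℝ) ^ 2 * stieltjes (fun s => s ^ n / (1 + s ^ n) ^ 2) 2 (ρ ^ 2) := by
    intro ρ
    simp only [hF, stieltjes, div_div, mul_comm]
  have hmain := integral_deriv_log_stieltjes hi hi2 hw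
    (fun x y u v hx hxy hu huv => pow_div_one_add_pow_sq_likelihood_ratio n hx hxy hu huv)
    (C := π * (n : ℝ) ^ 2) (by positivity) hFS
  have hI : ∫ ρ in Ioi (0 : ℝ), ρ * F ρ * κ ρ = 2 := by
    rw [← neg_neg (2 : ℝ), ← hmain, ← integral_neg]
    refine setIntegral_congr_fun measurableSet_Ioi fun ρ hρ => ?_
    have hρ : 0 < ρ := hρ
    have hFpos : 0 < F ρ := by
      have := stieltjes_pos hi hw 2 (pow_pos hρ 2)
      rw [hFS]
      positivity
    simp only [hκ]
    field_simp
  rw [hI]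
  exact ⟨by ring, by ring⟩
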